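/- arXiv:2112.15504 — 2 statements merged into one kernel-verified Lean document; each statement's English description precedes it below -/
import Mathlib

section
/- Let 0 < γ0 ≤ γ1 < 1. There exist constants C1 > 0 and C2 > 0 depending only on γ0 and γ1 such that for every γ ∈ [γ0, γ1] and every real x ≤ 0, C1/(Γ(1−γ)(1−x)) ≤ E_γ(x) ≤ C2/(Γ(1−γ)(1−x)). -/
open PowerSeries Filter Topology
/-- The Mittag-Leffler function `E_γ(x) = ∑ x^k / Γ(γ k + 1)`. -/
noncomputable def mlE (γ x : ℝ) : ℝ := ∑' k : ℕ, x ^ k / Real.Gamma (γ * k + 1)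

noncomputable def ppc (r : ℝ) (n : ℕ) : ℝ := ∏ i ∈ Finset.range n, (r + i) / (i + 1)
noncomputable def PP (r : ℝ) : PowerSeries ℝ := PowerSeries.mk (ppc r)

lemma ppc_zero (r : ℝ) : ppc r 0 = 1 := by simp [ppc]
lemma ppc_succ (r : ℝ) (n : ℕ) : ppc r (n+1) = ppc r n * ((r + n) / (n + 1)) := by
  rw [ppc, Finset.prod_range_succ]; rfl
lemma ppc_one (n : ℕ) : ppc 1 n = 1 := by
  apply Finset.prod_eq_one; intro i _
  have : (i:ℝ) + 1 ≠ 0 := by positivity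
  rw [add_comm]; field_simp
lemma ppc_nonneg {r : ℝ} (hr : 0 ≤ r) (n : ℕ) : 0 ≤ ppc r n :=
  Finset.prod_nonneg fun i _ => by positivity
lemma ppc_pos {r : ℝ} (hr : 0 < r) (n : ℕ) : 0 < ppc r n :=
  Finset.prod_pos fun i _ => by positivity
lemma ppc_neg {g : ℝ} (h0 : 0 ≤ g) (h1 : g ≤ 1) (n : ℕ) : ppc (-g) (n+1) ≤ 0 := by
  induction n with
  | zero => simp [ppc]; exact h0
  | succ n ih =>
    rw [ppc_succ]
    apply mul_nonpos_of_nonpos_of_nonneg ih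
    push_cast
    apply div_nonneg <;> [(have : (0:ℝ) ≤ n := by positivity
                           linarith); positivity]
lemma ppc_antitone {r : ℝ} (h0 : 0 ≤ r) (h1 : r ≤ 1) : Antitone (ppc r) := by
  apply antitone_nat_of_succ_le
  intro n
  rw [ppc_succ]
  apply mul_le_of_le_one_right (ppc_nonneg h0 n)
  rw [div_le_one (by positivity)]; linarith

lemma PP_uniq (r : ℝ) (F : PowerSeries ℝ) (h0 : coeff 0 F = 1)
    (h : (1 - X) * PowerSeries.derivative ℝ F = C r * F) : F = PP r := by
  ext n
  simp only [PP, coeff_mk]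
  induction n with
  | zero => rw [h0, ppc_zero]
  | succ n ih =>
    have := congrArg (coeff n) h
    rw [sub_mul, one_mul, map_sub, coeff_C_mul, coeff_derivative] at this
    have h2 : coeff n (X * PowerSeries.derivative ℝ F) = n * coeff n F := by
      cases n with
      | zero => simp
      | succ m => rw [mul_comm, coeff_succ_mul_X, coeff_derivative]; push_cast; ring
    rw [h2, ih] at this
    rw [ppc_succ]
    have h3 : (n:ℝ) + 1 ≠ 0 := by positivity
    field_simp
    linarith

lemma PP_deriv (r : ℝ) : (1 - X) * PowerSeries.derivative ℝ (PP r) = C r * PP r := by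
  ext n
  rw [sub_mul, one_mul, map_sub, coeff_C_mul, coeff_derivative]
  have h2 : coeff n (X * PowerSeries.derivative ℝ (PP r)) = n * coeff n (PP r) := by
      cases n with
      | zero => simp
      | succ m => rw [mul_comm, coeff_succ_mul_X, coeff_derivative]; push_cast; ring
  rw [h2]
  simp only [PP, coeff_mk]
  rw [ppc_succ]
  have h3 : (n:ℝ) + 1 ≠ 0 := by positivity
  field_simp
  ring

lemma PP_mul (r s : ℝ) : PP r * PP s = PP (r + s) := by
  apply PP_uniq
  · simp [coeff_mul, PP, ppc_zero]
  · rw [Derivation.leibniz, smul_eq_mul, smul_eq_mul]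
    have h1 := PP_deriv r
    have h2 := PP_deriv s
    rw [map_add]
    linear_combination PP s * h1 + PP r * h2

lemma PP_zero : PP 0 = 1 := by
  symm; apply PP_uniq
  · simp
  · simp

lemma PP_neg_one : PP (-1) = 1 - X := by
  symm; apply PP_uniq
  · simp
  · have : PowerSeries.derivative ℝ (1 - X : PowerSeries ℝ) = -1 := by
      have := (PowerSeries.derivative ℝ).map_sub 1 X
      simpa using this
    rw [this]; simp

lemma PP_one_coeff (n : ℕ) : coeff n (PP 1) = 1 := by simp [PP, ppc_one]

lemma coeff_mul_PP_one (F : PowerSeries ℝ) (n : ℕ) :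
    coeff n (F * PP 1) = ∑ p ∈ Finset.HasAntidiagonal.antidiagonal n, coeff p.1 F := by
  rw [coeff_mul]; simp [PP_one_coeff]

lemma mul_nonneg_coeff {F G : PowerSeries ℝ} (hF : ∀ n, 0 ≤ coeff n F) (hG : ∀ n, 0 ≤ coeff n G)
    (n : ℕ) : 0 ≤ coeff n (F * G) := by
  rw [coeff_mul]; exact Finset.sum_nonneg fun p _ => mul_nonneg (hF _) (hG _)

/-- bounds for the discrete solution -/
lemma disc_bounds {g μ : ℝ} (hg0 : 0 < g) (hg1 : g < 1) (hμ : 0 ≤ μ) (U : PowerSeries ℝ)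
    (hU : U + C μ * (PP g * U) = PP 1) (n : ℕ) :
    coeff n U * (1 + μ * ppc (1 + g) n) ≤ 1 ∧
    ppc (1 - g) n ≤ coeff n U * (μ + ppc (1 - g) n) := by
  set A : PowerSeries ℝ := PP (-g) + C μ with hA
  have hA0 : constantCoeff A = 1 + μ := by
    rw [← coeff_zero_eq_constantCoeff_apply]
    simp [hA, PP, ppc_zero]
  set W := A⁻¹ with hW
  have hAW : A * W = 1 := PowerSeries.mul_inv_cancel A (by rw [hA0]; positivity)
  have hWn : ∀ n, 0 ≤ coeff n W := by
    intro n
    induction n using Nat.strong_induction_on with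
    | _ n ih =>
      have h := congrArg (coeff n) hAW
      have e : A = C (1 + μ) + (PP (-g) - 1) := by rw [hA, map_add, map_one]; ring
      rw [e, add_mul, map_add, coeff_C_mul, coeff_mul] at h
      have h2 : ∑ p ∈ Finset.HasAntidiagonal.antidiagonal n, coeff p.1 (PP (-g) - 1) * coeff p.2 W ≤ 0 := by
        apply Finset.sum_nonpos
        rintro ⟨i, j⟩ hij
        rw [Finset.HasAntidiagonal.mem_antidiagonal] at hij
        simp only at hij ⊢
        cases i with
        | zero => simp [PP, ppc_zero]
        | succ i =>
          apply mul_nonpos_of_nonpos_of_nonneg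
          · simpa [PP, coeff_one] using ppc_neg hg0.le hg1.le i
          · exact ih j (by omega)
      have h3 : 0 ≤ coeff n (1 : PowerSeries ℝ) := by
        rw [coeff_one]; split_ifs <;> norm_num
      have h4 : 0 ≤ (1 + μ) * coeff n W := by linarith
      exact nonneg_of_mul_nonneg_right h4 (by positivity)
  have hAU : A * U = PP (1 - g) := by
    have e1 : PP (-g) * PP g = 1 := by rw [PP_mul, neg_add_cancel, PP_zero]
    have e2 : PP (-g) * PP 1 = PP (1 - g) := by rw [PP_mul]; congr 1; ring
    rw [← e2, ← hU, hA]
    linear_combination (-C μ * U) * e1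
  have hUW : U = PP (1 - g) * W := by
    rw [← hAU]; linear_combination (-U) * hAW
  have hUn : ∀ n, 0 ≤ coeff n U := by
    rw [hUW]
    exact mul_nonneg_coeff (fun n => by simpa [PP] using ppc_nonneg (by linarith) n) hWn
  have hD : (1 - X) * U = 1 - C μ * W := by
    have e2 : PP (-1) * PP (1 - g) = PP (-g) := by rw [PP_mul]; congr 1; ring
    rw [← PP_neg_one, hUW, ← mul_assoc, e2, ← hAW, hA]; ring
  have hanti : Antitone fun n => coeff n U := by
    apply antitone_nat_of_succ_le
    intro n
    have h := congrArg (coeff (n+1)) hD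
    rw [sub_mul, one_mul, map_sub, map_sub, mul_comm X, coeff_succ_mul_X, coeff_C_mul,
      coeff_one, if_neg (by omega)] at h
    have := mul_nonneg hμ (hWn (n+1))
    linarith
  constructor
  · have h := congrArg (coeff n) hU
    rw [map_add, coeff_C_mul, PP_one_coeff, coeff_mul] at h
    have h1 : ppc (1 + g) n = ∑ p ∈ Finset.HasAntidiagonal.antidiagonal n, coeff p.1 (PP g) := by
      rw [← coeff_mul_PP_one, PP_mul, add_comm]; simp [PP]
    have h2 : ppc (1 + g) n * coeff n U ≤
        ∑ p ∈ Finset.HasAntidiagonal.antidiagonal n, coeff p.1 (PP g) * coeff p.2 U := by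
      rw [h1, Finset.sum_mul]
      apply Finset.sum_le_sum
      rintro ⟨i, j⟩ hij
      rw [Finset.HasAntidiagonal.mem_antidiagonal] at hij
      simp only at hij ⊢
      apply mul_le_mul_of_nonneg_left (hanti (by omega : j ≤ n))
      simpa [PP] using ppc_nonneg hg0.le i
    have := mul_le_mul_of_nonneg_left h2 hμ
    linarith
  · have e1 : (C μ * W) * PP 1 = PP 1 - U := by
      have e2 : PP (-1) * PP 1 = 1 := by rw [PP_mul, neg_add_cancel, PP_zero]
      rw [← PP_neg_one] at hD
      linear_combination PP 1 * hD - U * e2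
    have h1 : 1 - coeff n U = ∑ p ∈ Finset.HasAntidiagonal.antidiagonal n, coeff p.1 (C μ * W) := by
      rw [← coeff_mul_PP_one, e1, map_sub, PP_one_coeff]
    have h2 : μ * coeff n U = coeff n ((C μ * W) * PP (1 - g)) := by
      rw [← coeff_C_mul, hUW]; congr 1; ring
    have h3 : (1 - coeff n U) * ppc (1 - g) n ≤ μ * coeff n U := by
      rw [h1, h2, coeff_mul, Finset.sum_mul]
      apply Finset.sum_le_sum
      rintro ⟨i, j⟩ hij
      rw [Finset.HasAntidiagonal.mem_antidiagonal] at hij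
      simp only at hij ⊢
      apply mul_le_mul_of_nonneg_left
      · simpa [PP] using ppc_antitone (by linarith) (by linarith) (by omega : j ≤ n)
      · rw [coeff_C_mul]; exact mul_nonneg hμ (hWn _)
    linarith

lemma ppc_le {g : ℝ} (h0 : 0 ≤ g) (h1 : g ≤ 1) (k n : ℕ) : ppc (1 + g * k) n ≤ ((k:ℝ) + 1) ^ n := by
  rw [ppc, ← Finset.card_range n, ← Finset.prod_const, Finset.card_range]
  apply Finset.prod_le_prod
  · intro i _; positivity
  · intro i _
    rw [div_le_iff₀ (by positivity)]
    have : g * k ≤ k := mul_le_of_le_one_left (by positivity) h1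
    have : (0:ℝ) ≤ k * i := by positivity
    linarith

lemma summable_dom {r : ℝ} (h0 : 0 ≤ r) (h1 : r < 1) (n : ℕ) :
    Summable fun k : ℕ => ((k:ℝ) + 1) ^ n * r ^ k := by
  set q := (1 + r) / 2 with hq
  have hq0 : 0 < q := by positivity
  have hq1 : q < 1 := by linarith
  have hrq : r ≤ q := by linarith
  have h := summable_pow_mul_geometric_of_norm_lt_one n (r := q)
    (by rw [Real.norm_of_nonneg hq0.le]; exact hq1)
  have h2 := ((summable_nat_add_iff 1).2 h).mul_right q⁻¹
  refine Summable.of_nonneg_of_le (fun k => by positivity) (fun k => ?_) h2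
  have : ((k:ℝ) + 1) ^ n * r ^ k ≤ ((k:ℝ) + 1) ^ n * q ^ k := by gcongr
  refine this.trans (le_of_eq ?_)
  push_cast
  field_simp
  ring

lemma summable_u {g μ : ℝ} (h0 : 0 ≤ g) (h1 : g ≤ 1) (hμ : 0 ≤ μ) (hμ1 : μ < 1) (n : ℕ) :
    Summable fun k : ℕ => (-μ) ^ k * ppc (1 + g * k) n := by
  refine Summable.of_norm_bounded (summable_dom hμ hμ1 n) fun k => ?_
  rw [norm_mul, norm_pow, norm_neg, Real.norm_of_nonneg hμ,
    Real.norm_of_nonneg (ppc_nonneg (by positivity) n), mul_comm]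
  gcongr
  exact ppc_le h0 h1 k n

lemma U_eq {g μ : ℝ} (h0 : 0 ≤ g) (h1 : g ≤ 1) (hμ : 0 ≤ μ) (hμ1 : μ < 1) :
    PowerSeries.mk (fun n => ∑' k : ℕ, (-μ) ^ k * ppc (1 + g * k) n) +
      C μ * (PP g * PowerSeries.mk (fun n => ∑' k : ℕ, (-μ) ^ k * ppc (1 + g * k) n)) = PP 1 := by
  ext n
  rw [map_add, coeff_C_mul, PP_one_coeff, coeff_mul]
  simp only [coeff_mk, PP]
  have hs := fun m => summable_u h0 h1 hμ hμ1 m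
  have e : ∑ p ∈ Finset.HasAntidiagonal.antidiagonal n,
      ppc g p.1 * ∑' k : ℕ, (-μ) ^ k * ppc (1 + g * k) p.2
      = ∑' k : ℕ, (-μ) ^ k * ppc (1 + g * (k + 1 : ℕ)) n := by
    have e1 : ∀ p ∈ Finset.HasAntidiagonal.antidiagonal n,
        ppc g p.1 * ∑' k : ℕ, (-μ) ^ k * ppc (1 + g * k) p.2
        = ∑' k : ℕ, ppc g p.1 * ((-μ) ^ k * ppc (1 + g * k) p.2) := fun p _ => tsum_mul_left.symm
    rw [Finset.sum_congr rfl e1]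
    have e3 := Summable.tsum_finsetSum (s := Finset.HasAntidiagonal.antidiagonal n)
      (f := fun (p : ℕ × ℕ) (k : ℕ) => ppc g p.1 * ((-μ) ^ k * ppc (1 + g * k) p.2))
      (fun p _ => (hs p.2).mul_left (ppc g p.1))
    refine e3.symm.trans (tsum_congr fun k => ?_)
    have := congrArg (coeff n) (PP_mul g (1 + g * k))
    rw [coeff_mul] at this
    simp only [coeff_mk, PP] at this
    have e2 : 1 + g * ((k + 1 : ℕ) : ℝ) = g + (1 + g * k) := by push_cast; ring
    rw [e2, ← this, Finset.mul_sum]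
    apply Finset.sum_congr rfl
    intros; ring
  rw [e, (hs n).tsum_eq_zero_add, ← tsum_mul_left]
  simp only [pow_zero, one_mul, Nat.cast_zero, mul_zero, add_zero, ppc_one]
  rw [add_assoc, add_eq_left, ← sub_neg_eq_add, sub_eq_zero, ← tsum_neg]
  congr 1; ext k
  rw [pow_succ]; ring

lemma ppc_tendsto {s : ℝ} (hs : 0 < s) :
    Tendsto (fun n : ℕ => ppc s n * (n:ℝ) ^ (1 - s)) atTop (𝓝 (1 / Real.Gamma s)) := by
  have h1 := (Real.GammaSeq_tendsto_Gamma s).inv₀ (Real.Gamma_pos_of_pos hs).ne'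
  have h2 : Tendsto (fun n : ℕ => (n:ℝ) / (n + s)) atTop (𝓝 1) :=
    tendsto_natCast_div_add_atTop s
  have h3 := h2.mul h1
  rw [one_mul, ← one_div] at h3
  refine h3.congr' ?_
  filter_upwards [eventually_gt_atTop 0] with n hn
  have hn' : (0:ℝ) < n := by exact_mod_cast hn
  rw [Real.GammaSeq, Finset.prod_range_succ, ppc, Finset.prod_div_distrib,
    Real.rpow_sub hn', Real.rpow_one]
  have : (∏ i ∈ Finset.range n, ((i:ℝ) + 1)) = (n.factorial : ℝ) := by
    rw [← Finset.prod_range_add_one_eq_factorial]; push_cast; rfl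
  rw [this]
  have h4 : (0:ℝ) < n.factorial := by exact_mod_cast n.factorial_pos
  have h5 : 0 < ∏ i ∈ Finset.range n, (s + (i:ℝ)) := Finset.prod_pos fun i _ => by positivity
  have h6 : (0:ℝ) < (n:ℝ) ^ s := by positivity
  have h7 : s + (n:ℝ) ≠ 0 := by positivity
  have h8 : (n:ℝ) + s ≠ 0 := by positivity
  field_simp
  ring

lemma ppc_anti {s : ℝ} (hs : 0 ≤ s) {M n : ℕ} (hM : 1 ≤ M) (hn : M ≤ n) :
    ppc (1 + s) n * (n:ℝ) ^ (-s) ≤ ppc (1 + s) M * (M:ℝ) ^ (-s) := by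
  induction n, hn using Nat.le_induction with
  | base => exact le_rfl
  | succ n hn ih =>
    refine le_trans ?_ ih
    have hn' : (0:ℝ) < n := by exact_mod_cast (by omega : 0 < n)
    rw [ppc_succ, mul_assoc]
    apply mul_le_mul_of_nonneg_left _ (ppc_nonneg (by positivity) n)
    push_cast
    have e : (n:ℝ) ^ (-s) = ((n:ℝ) + 1) ^ (-s) * (((n:ℝ) + 1) / n) ^ s := by
      rw [Real.div_rpow (by positivity) hn'.le, Real.rpow_neg (by positivity),
        Real.rpow_neg (by positivity)]
      field_simp
    rw [e, mul_comm]
    apply mul_le_mul_of_nonneg_left _ (by positivity)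
    have h1 : 1 - (((n:ℝ) + 1) / n)⁻¹ ≤ Real.log (((n:ℝ) + 1) / n) :=
      Real.one_sub_inv_le_log_of_pos (by positivity)
    rw [Real.rpow_def_of_pos (by positivity)]
    have h2 : (1 + s + n) / ((n:ℝ) + 1) = s * (1 - (((n:ℝ) + 1) / n)⁻¹) + 1 := by
      field_simp; ring
    rw [h2]
    refine (Real.add_one_le_exp _).trans (Real.exp_le_exp.2 ?_)
    rw [mul_comm]
    exact mul_le_mul_of_nonneg_right h1 hs

lemma mu_tendsto {g : ℝ} (hg : 0 < g) (t : ℝ) :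
    Tendsto (fun n : ℕ => t * (n:ℝ) ^ (-g)) atTop (𝓝 0) := by
  have := ((tendsto_rpow_neg_atTop hg).comp tendsto_natCast_atTop_atTop).const_mul t
  simpa using this

lemma u_tendsto {g t : ℝ} (h0 : 0 < g) (h1 : g ≤ 1) (ht : 0 ≤ t) :
    Tendsto (fun n : ℕ => ∑' k : ℕ, (-(t * (n:ℝ) ^ (-g))) ^ k * ppc (1 + g * k) n) atTop
      (𝓝 (mlE g (-t))) := by
  obtain ⟨M, hM1, hM⟩ := ((eventually_ge_atTop 1).and
    ((mu_tendsto h0 t).eventually (gt_mem_nhds (zero_lt_one)))).exists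
  have key : ∀ (n k : ℕ), (t * (n:ℝ) ^ (-g)) ^ k = t ^ k * (n:ℝ) ^ (-(g * k)) := by
    intro n k
    rw [mul_pow, ← Real.rpow_mul_natCast (by positivity), neg_mul]
  refine tendsto_tsum_of_dominated_convergence (summable_dom (by positivity) hM M) ?_ ?_
  · intro k
    have := (ppc_tendsto (s := 1 + g * k) (by positivity)).const_mul ((-t) ^ k)
    rw [mul_one_div, add_comm 1 (g * k)] at this
    refine this.congr fun n => ?_
    rw [neg_pow (t * _), key, neg_pow t, add_comm (g * k) 1,
      show 1 - (1 + g * (k:ℝ)) = -(g * k) by ring]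
    ring
  · filter_upwards [eventually_ge_atTop M] with n hn k
    rw [norm_mul, norm_pow, norm_neg, Real.norm_of_nonneg (by positivity : 0 ≤ t * (n:ℝ) ^ (-g)),
      Real.norm_of_nonneg (ppc_nonneg (by positivity) n), key, key]
    have h3 := ppc_anti (s := g * k) (by positivity) hM1 hn
    have h4 := ppc_le h0.le h1 k M
    calc _ = t ^ k * (ppc (1 + g * k) n * (n:ℝ) ^ (-(g * k))) := by ring
      _ ≤ t ^ k * (ppc (1 + g * k) M * (M:ℝ) ^ (-(g * k))) := by gcongr
      _ ≤ t ^ k * (((k:ℝ) + 1) ^ M * (M:ℝ) ^ (-(g * k))) := by gcongr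
      _ = _ := by ring

lemma ml_bounds {g t : ℝ} (h0 : 0 < g) (h1 : g < 1) (ht : 0 ≤ t) :
    mlE g (-t) * (1 + t / Real.Gamma (1 + g)) ≤ 1 ∧
    1 ≤ mlE g (-t) * (1 + t * Real.Gamma (1 - g)) := by
  have hu := u_tendsto h0 h1.le ht
  have hb : ∀ᶠ n : ℕ in atTop, 0 < n ∧ t * (n:ℝ) ^ (-g) < 1 :=
    (eventually_gt_atTop 0).and ((mu_tendsto h0 t).eventually (gt_mem_nhds zero_lt_one))
  have ha := ppc_tendsto (s := 1 + g) (by positivity)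
  have hc := ppc_tendsto (s := 1 - g) (by linarith)
  have hG : 0 < Real.Gamma (1 - g) := Real.Gamma_pos_of_pos (by linarith)
  constructor
  · rw [← mul_one_div t]
    refine le_of_tendsto (hu.mul ((ha.const_mul t).const_add 1)) ?_
    · filter_upwards [hb] with n hn
      have := (disc_bounds h0 h1 (by positivity) _
        (U_eq h0.le h1.le (by positivity) hn.2) n).1
      rw [coeff_mk] at this
      refine le_trans (le_of_eq ?_) this
      rw [show 1 - (1 + g) = -g by ring]
      ring
  · have h2 : 1 / Real.Gamma (1 - g) ≤ mlE g (-t) * (t + 1 / Real.Gamma (1 - g)) := by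
      refine le_of_tendsto_of_tendsto hc (hu.mul (hc.const_add t)) ?_
      filter_upwards [hb] with n hn
      have := (disc_bounds h0 h1 (by positivity) _
        (U_eq h0.le h1.le (by positivity) hn.2) n).2
      rw [coeff_mk] at this
      have hn' : (0:ℝ) < n := by exact_mod_cast hn.1
      have e : (n:ℝ) ^ (-g) * (n:ℝ) ^ g = 1 := by
        rw [← Real.rpow_add hn']; simp
      have h5 := mul_le_mul_of_nonneg_right this (by positivity : 0 ≤ (n:ℝ) ^ g)
      rw [show 1 - (1 - g) = g by ring]
      refine h5.trans (le_of_eq ?_)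
      rw [mul_assoc, add_mul, mul_assoc t, e, mul_one]
    have h3 := mul_le_mul_of_nonneg_right h2 hG.le
    rw [one_div, inv_mul_cancel₀ hG.ne', mul_assoc, add_mul, inv_mul_cancel₀ hG.ne'] at h3
    linarith

theorem stmt_0 (γ0 γ1 : ℝ) (h0 : 0 < γ0) (h01 : γ0 ≤ γ1) (h1 : γ1 < 1) :
    ∃ C1 C2 : ℝ, 0 < C1 ∧ 0 < C2 ∧
      ∀ γ ∈ Set.Icc γ0 γ1, ∀ x : ℝ, x ≤ 0 →
        C1 / (Real.Gamma (1 - γ) * (1 - x)) ≤ mlE γ x ∧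
        mlE γ x ≤ C2 / (Real.Gamma (1 - γ) * (1 - x)) := by
  have hcont : ∀ s : ℝ, 0 < s → ContinuousAt Real.Gamma s := fun s hs =>
    (Real.differentiableAt_Gamma (fun m => by
      have : (0:ℝ) ≤ m := by positivity
      linarith)).continuousAt
  have hK : IsCompact (Set.Icc γ0 γ1) := isCompact_Icc
  have hne : (Set.Icc γ0 γ1).Nonempty := ⟨γ0, le_rfl, h01⟩
  have c1 : ContinuousOn (fun γ => Real.Gamma (1 - γ)) (Set.Icc γ0 γ1) := fun γ hγ =>
    (ContinuousAt.comp (f := fun γ : ℝ => 1 - γ) (hcont (1 - γ) (by linarith [hγ.2]))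
      (by fun_prop)).continuousWithinAt
  have c2 : ContinuousOn (fun γ => Real.Gamma (1 + γ)) (Set.Icc γ0 γ1) := fun γ hγ =>
    (ContinuousAt.comp (f := fun γ : ℝ => 1 + γ) (hcont (1 + γ) (by linarith [hγ.1]))
      (by fun_prop)).continuousWithinAt
  obtain ⟨a, ha, ha'⟩ := hK.exists_isMinOn hne c1
  obtain ⟨b, hb, hb'⟩ := hK.exists_isMaxOn hne c1
  obtain ⟨c, hc, hc'⟩ := hK.exists_isMaxOn hne c2
  have pa : 0 < Real.Gamma (1 - a) := Real.Gamma_pos_of_pos (by linarith [ha.2])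
  have pb : 0 < Real.Gamma (1 - b) := Real.Gamma_pos_of_pos (by linarith [hb.2])
  refine ⟨min 1 (Real.Gamma (1 - a)), Real.Gamma (1 - b) * max 1 (Real.Gamma (1 + c)),
    by positivity, by positivity, ?_⟩
  intro γ hγ x hx
  obtain ⟨t, rfl⟩ : ∃ t, x = -t := ⟨-x, by ring⟩
  have ht : 0 ≤ t := by linarith
  obtain ⟨hu, hl⟩ := ml_bounds (lt_of_lt_of_le h0 hγ.1) (lt_of_le_of_lt hγ.2 h1) ht
  have ga : Real.Gamma (1 - a) ≤ Real.Gamma (1 - γ) := ha' hγ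
  have gb : Real.Gamma (1 - γ) ≤ Real.Gamma (1 - b) := hb' hγ
  have gc : Real.Gamma (1 + γ) ≤ Real.Gamma (1 + c) := hc' hγ
  have pG : 0 < Real.Gamma (1 - γ) := pa.trans_le ga
  have pH : 0 < Real.Gamma (1 + γ) := Real.Gamma_pos_of_pos (by linarith [hγ.1])
  set G := Real.Gamma (1 - γ)
  set H := Real.Gamma (1 + γ)
  set E := mlE γ (-t)
  have hE : 0 < E := by
    by_contra hcon
    have : E * (1 + t * G) ≤ 0 := mul_nonpos_of_nonpos_of_nonneg (not_lt.1 hcon) (by positivity)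
    linarith
  rw [sub_neg_eq_add]
  constructor
  · rw [div_le_iff₀ (by positivity)]
    set m := min 1 (Real.Gamma (1 - a))
    have m1 : m ≤ 1 := min_le_left _ _
    have m2 : m ≤ G := (min_le_right _ _).trans ga
    have m0 : 0 < m := by positivity
    have h3 : m * (1 + t * G) ≤ G * (1 + t) := by
      have : m * (t * G) ≤ 1 * (t * G) := by gcongr
      linarith
    calc m ≤ m * (E * (1 + t * G)) := le_mul_of_one_le_right m0.le hl
      _ = E * (m * (1 + t * G)) := by ring
      _ ≤ _ := by gcongr
  · rw [le_div_iff₀ (by positivity)]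
    set N := max 1 (Real.Gamma (1 + c))
    have n1 : 1 ≤ N := le_max_left _ _
    have n2 : H ≤ N := gc.trans (le_max_right _ _)
    have h3 : 1 + t ≤ N * (1 + t / H) := by
      have : t ≤ N * (t / H) := by
        calc t = H * (t / H) := by field_simp
          _ ≤ _ := by gcongr
      linarith
    calc E * (G * (1 + t)) ≤ E * (Real.Gamma (1 - b) * (N * (1 + t / H))) := by gcongr
      _ = Real.Gamma (1 - b) * N * (E * (1 + t / H)) := by ring
      _ ≤ Real.Gamma (1 - b) * N * 1 := by gcongr
      _ = _ := by ring
end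

section
/- Let 0 < γ0 ≤ γ1 < 1 and T > 0. There exist constants C1 > 0 and C2 > 0 depending only on γ0 and γ1 such that for every γ ∈ [γ0, γ1], every ξ ∈ ℝⁿ and every t ∈ (0, T], (1/max(1, t^γ)) · C1/(Γ(1−γ)(1+|ξ|²)) ≤ E_γ(−|ξ|² t^γ) ≤ (1/min(1, t^γ)) · C2/(Γ(1−γ)(1+|ξ|²)). -/
open MeasureTheory Set Filter Topology

/-- The fractional integration kernel. -/
noncomputable def mlk (δ t : ℝ) : ℝ := t ^ (δ - 1) / Real.Gamma δ

/-- Two-parameter Mittag-Leffler function at `-x`. -/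
noncomputable def mlG (γ β x : ℝ) : ℝ := ∑' n : ℕ, (-x) ^ n / Real.Gamma (γ * n + β)

/-- The kernel version of the Mittag-Leffler function. -/
noncomputable def mlF (γ β t : ℝ) : ℝ := t ^ (β - 1) * mlG γ β (t ^ γ)

lemma ml_gamma_ratio {γ y : ℝ} (h0 : 0 < γ) (h1 : γ < 1) (hy : 1 ≤ y) :
    Real.Gamma y ≤ 2 * y ^ (-γ) * Real.Gamma (y + γ) := by
  have hy0 : 0 < y := by linarith
  have h := Real.Gamma_mul_add_mul_le_rpow_Gamma_mul_rpow_Gamma (s := y + γ) (t := y + γ + 1)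
    (a := γ) (b := 1 - γ) (by linarith) (by linarith) h0 (by linarith) (by ring)
  have e : γ * (y + γ) + (1 - γ) * (y + γ + 1) = y + 1 := by ring
  have hG : 0 < Real.Gamma (y + γ) := Real.Gamma_pos_of_pos (by linarith)
  rw [e, Real.Gamma_add_one hy0.ne', Real.Gamma_add_one (by linarith : y + γ ≠ 0),
    Real.mul_rpow (by linarith) hG.le] at h
  have e2 : Real.Gamma (y + γ) ^ γ * ((y + γ) ^ (1 - γ) * Real.Gamma (y + γ) ^ (1 - γ))
      = (y + γ) ^ (1 - γ) * Real.Gamma (y + γ) := by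
    have : Real.Gamma (y + γ) ^ γ * Real.Gamma (y + γ) ^ (1 - γ) = Real.Gamma (y + γ) := by
      rw [← Real.rpow_add hG]; simp
    linear_combination (y + γ) ^ (1 - γ) * this
  rw [e2] at h
  have h3 : (y + γ) ^ (1 - γ) ≤ 2 * (y * y ^ (-γ)) := by
    calc (y + γ) ^ (1 - γ) ≤ (2 * y) ^ (1 - γ) :=
          Real.rpow_le_rpow (by linarith) (by linarith) (by linarith)
      _ = 2 ^ (1 - γ) * y ^ (1 - γ) := Real.mul_rpow (by norm_num) hy0.le
      _ ≤ 2 ^ (1 : ℝ) * y ^ (1 - γ) := by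
          gcongr
          · norm_num
          · linarith
      _ = 2 * (y * y ^ (-γ)) := by
          rw [Real.rpow_one, sub_eq_add_neg, Real.rpow_add hy0, Real.rpow_one]
  have h4 : y * Real.Gamma y ≤ y * (2 * y ^ (-γ) * Real.Gamma (y + γ)) := by
    calc _ ≤ _ := h
      _ ≤ 2 * (y * y ^ (-γ)) * Real.Gamma (y + γ) := by gcongr
      _ = _ := by ring
  exact le_of_mul_le_mul_left h4 hy0

lemma ml_arg_pos {γ β : ℝ} (h0 : 0 < γ) (hβ : 0 < β) (n : ℕ) : 0 < γ * n + β := by positivity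

lemma ml_summable {γ β : ℝ} (h0 : 0 < γ) (h1 : γ < 1) (hβ : 0 < β) (x : ℝ) :
    Summable (fun n : ℕ => x ^ n / Real.Gamma (γ * n + β)) := by
  apply summable_of_ratio_norm_eventually_le (r := 1/2) (by norm_num)
  have ht : Tendsto (fun n : ℕ => γ * n + β) atTop atTop :=
    tendsto_atTop_add_const_right _ _ (tendsto_natCast_atTop_atTop.const_mul_atTop h0)
  have ht2 : Tendsto (fun n : ℕ => |x| * (2 * (γ * n + β) ^ (-γ))) atTop (𝓝 (|x| * (2 * 0))) :=
    (((tendsto_rpow_neg_atTop h0).comp ht).const_mul 2).const_mul _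
  rw [mul_zero, mul_zero] at ht2
  filter_upwards [ht.eventually_ge_atTop 1, ht2.eventually_le_const (by norm_num : (0:ℝ) < 1/2)]
    with n hn1 hn2
  have hr := ml_gamma_ratio h0 h1 hn1
  have e : γ * ((n + 1 : ℕ) : ℝ) + β = γ * n + β + γ := by push_cast; ring
  have p1 := Real.Gamma_pos_of_pos (ml_arg_pos h0 hβ n)
  have p2 := Real.Gamma_pos_of_pos (ml_arg_pos h0 hβ (n+1))
  rw [e] at p2 ⊢
  rw [norm_div, norm_div, norm_pow, norm_pow, Real.norm_eq_abs, Real.norm_eq_abs, Real.norm_eq_abs,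
    abs_of_pos p1, abs_of_pos p2, pow_succ, div_le_iff₀ p2]
  have : |x| ≤ 1 / 2 / Real.Gamma (γ * n + β) * Real.Gamma (γ * n + β + γ) := by
    rw [div_mul_eq_mul_div, le_div_iff₀ p1]
    calc |x| * Real.Gamma (γ * n + β) ≤
        |x| * (2 * (γ * n + β) ^ (-γ) * Real.Gamma (γ * n + β + γ)) := by gcongr
      _ = |x| * (2 * (γ * n + β) ^ (-γ)) * Real.Gamma (γ * n + β + γ) := by ring
      _ ≤ _ := by gcongr
  calc |x| ^ n * |x| ≤ |x| ^ n * (1 / 2 / Real.Gamma (γ * n + β) * Real.Gamma (γ * n + β + γ)) := by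
        gcongr
    _ = _ := by ring

lemma mlG_continuousOn {γ β : ℝ} (h0 : 0 < γ) (h1 : γ < 1) (hβ : 0 < β) (R : ℝ) :
    ContinuousOn (mlG γ β) (Icc 0 R) := by
  unfold mlG
  apply continuousOn_tsum (u := fun n : ℕ => R ^ n / Real.Gamma (γ * n + β))
  · intro n; fun_prop
  · exact ml_summable h0 h1 hβ R
  · intro n x hx
    have p1 := Real.Gamma_pos_of_pos (ml_arg_pos h0 hβ n)
    rw [norm_div, norm_pow, norm_neg, Real.norm_eq_abs, Real.norm_eq_abs, abs_of_pos p1,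
      abs_of_nonneg hx.1]
    have := hx.1
    have := hx.2
    gcongr

lemma mlG_comp_continuousOn {γ β : ℝ} (h0 : 0 < γ) (h1 : γ < 1) (hβ : 0 < β) (R : ℝ) :
    ContinuousOn (fun t => mlG γ β (t ^ γ)) (Icc 0 R) := by
  apply (mlG_continuousOn h0 h1 hβ (R ^ γ)).comp
  · exact fun t _ => (Real.continuousAt_rpow_const _ _ (Or.inr h0.le)).continuousWithinAt
  · intro t ht
    exact ⟨Real.rpow_nonneg ht.1 _, Real.rpow_le_rpow ht.1 ht.2 h0.le⟩

lemma mlk_conv {α δ t : ℝ} (hα : 0 < α) (hδ : 0 < δ) (ht : 0 < t) :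
    ∫ s in (0:ℝ)..t, mlk δ (t - s) * mlk α s = mlk (α + δ) t := by
  have h := Complex.betaIntegral_scaled α δ ht
  have hb := Complex.Gamma_mul_Gamma_eq_betaIntegral (s := α) (t := δ) (by simpa) (by simpa)
  have p1 := Real.Gamma_pos_of_pos hα
  have p2 := Real.Gamma_pos_of_pos hδ
  have p3 := Real.Gamma_pos_of_pos (add_pos hα hδ)
  have h2 : ((∫ s in (0:ℝ)..t, s ^ (α - 1) * (t - s) ^ (δ - 1) : ℝ) : ℂ)
      = (t : ℂ) ^ ((α : ℂ) + δ - 1) * Complex.betaIntegral α δ := by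
    rw [← h, ← intervalIntegral.integral_ofReal]
    apply intervalIntegral.integral_congr
    intro s hs
    rw [uIcc_of_le ht.le] at hs
    simp only
    push_cast
    rw [Complex.ofReal_cpow hs.1, Complex.ofReal_cpow (by linarith [hs.2])]
    push_cast; rfl
  rw [← Complex.ofReal_add, Complex.Gamma_ofReal, Complex.Gamma_ofReal, Complex.Gamma_ofReal] at hb
  have h3 : (∫ s in (0:ℝ)..t, s ^ (α - 1) * (t - s) ^ (δ - 1)) * Real.Gamma (α + δ)
      = t ^ (α + δ - 1) * (Real.Gamma α * Real.Gamma δ) := by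
    apply Complex.ofReal_injective
    rw [Complex.ofReal_mul, h2, Complex.ofReal_mul, Complex.ofReal_cpow ht.le, Complex.ofReal_mul,
      hb]
    push_cast; ring
  have h4 : ∫ s in (0:ℝ)..t, mlk δ (t - s) * mlk α s
      = (∫ s in (0:ℝ)..t, s ^ (α - 1) * (t - s) ^ (δ - 1)) * (1 / (Real.Gamma α * Real.Gamma δ)) := by
    rw [← intervalIntegral.integral_mul_const]
    congr 1; ext s; unfold mlk; field_simp
  rw [h4, mlk]
  field_simp
  linarith

lemma mlk_pos {δ t : ℝ} (hδ : 0 < δ) (ht : 0 < t) : 0 < mlk δ t :=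
  div_pos (Real.rpow_pos_of_pos ht _) (Real.Gamma_pos_of_pos hδ)

lemma mlk_nonneg {δ t : ℝ} (hδ : 0 < δ) (ht : 0 ≤ t) : 0 ≤ mlk δ t :=
  div_nonneg (Real.rpow_nonneg ht _) (Real.Gamma_pos_of_pos hδ).le

lemma mlk_conv_int {α δ t : ℝ} (hα : 0 < α) (hδ : 0 < δ) (ht : 0 < t) :
    IntervalIntegrable (fun s => mlk δ (t - s) * mlk α s) volume 0 t := by
  by_contra hc
  have h := mlk_conv hα hδ ht
  rw [intervalIntegral.integral_undef hc] at h
  exact (mlk_pos (add_pos hα hδ) ht).ne h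

lemma mlF_hasSum {γ β t : ℝ} (h0 : 0 < γ) (h1 : γ < 1) (hβ : 0 < β) (ht : 0 < t) :
    HasSum (fun n : ℕ => (-1) ^ n * mlk (γ * n + β) t) (mlF γ β t) := by
  have h := ((ml_summable h0 h1 hβ (-(t ^ γ))).hasSum).mul_left (t ^ (β - 1))
  refine h.congr_fun ?_ |> fun h' => h'
  intro n
  rw [mlk, show γ * n + β - 1 = (β - 1) + γ * n by ring, Real.rpow_add ht, Real.rpow_mul ht.le,
    Real.rpow_natCast, neg_pow (t ^ γ)]
  ring

lemma ml_summable_abs {γ β t : ℝ} (h0 : 0 < γ) (h1 : γ < 1) (hβ : 0 < β) (ht : 0 < t) :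
    Summable (fun n : ℕ => mlk (γ * n + β) t) := by
  have h := (ml_summable h0 h1 hβ (t ^ γ)).mul_left (t ^ (β - 1))
  refine h.congr ?_
  intro n
  rw [mlk, show γ * n + β - 1 = (β - 1) + γ * n by ring, Real.rpow_add ht, Real.rpow_mul ht.le,
    Real.rpow_natCast]
  ring

lemma mlF_conv {γ β δ t : ℝ} (h0 : 0 < γ) (h1 : γ < 1) (hβ : 0 < β) (hδ : 0 < δ) (ht : 0 < t) :
    ∫ s in (0:ℝ)..t, mlk δ (t - s) * mlF γ β s = mlF γ (β + δ) t := by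
  have key := hasSum_integral_of_summable_integral_norm (μ := volume.restrict (Ioc 0 t))
    (F := fun (n : ℕ) s => (-1) ^ n * (mlk δ (t - s) * mlk (γ * n + β) s)) ?_ ?_
  · rw [intervalIntegral.integral_of_le ht.le]
    have e1 : ∫ s in Ioc 0 t, mlk δ (t - s) * mlF γ β s
        = ∫ s in Ioc 0 t, ∑' n : ℕ, (-1) ^ n * (mlk δ (t - s) * mlk (γ * n + β) s) := by
      apply setIntegral_congr_fun measurableSet_Ioc
      intro s hs
      have := (mlF_hasSum h0 h1 hβ hs.1).mul_left (mlk δ (t - s))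
      simp only
      rw [← this.tsum_eq]
      congr 1; ext n; ring
    rw [e1]
    refine key.unique ?_
    refine (mlF_hasSum h0 h1 (add_pos hβ hδ) ht).congr_fun ?_ |> fun h' => h'
    intro n
    rw [integral_const_mul, ← intervalIntegral.integral_of_le ht.le,
      mlk_conv (ml_arg_pos h0 hβ n) hδ ht, add_assoc]
  · intro n
    have := mlk_conv_int (ml_arg_pos h0 hβ n) hδ ht
    rw [intervalIntegrable_iff_integrableOn_Ioc_of_le ht.le] at this
    exact this.const_mul _
  · refine (ml_summable_abs h0 h1 (add_pos hβ hδ) ht).congr ?_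
    intro n
    rw [← add_assoc, ← mlk_conv (ml_arg_pos h0 hβ n) hδ ht, intervalIntegral.integral_of_le ht.le]
    apply setIntegral_congr_fun measurableSet_Ioc
    intro s hs
    simp only [norm_mul, norm_pow, norm_neg, norm_one, one_pow, one_mul]
    rw [Real.norm_of_nonneg (mlk_nonneg hδ (by linarith [hs.2])),
      Real.norm_of_nonneg (mlk_nonneg (ml_arg_pos h0 hβ n) hs.1.le)]

lemma mlF_conv_int {γ β δ t : ℝ} (h0 : 0 < γ) (h1 : γ < 1) (hβ : 0 < β) (hδ : 0 < δ)
    (ht : 0 < t) :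
    IntervalIntegrable (fun s => mlk δ (t - s) * mlF γ β s) volume 0 t := by
  have h := (mlk_conv_int hβ hδ ht).mul_continuousOn
    (g := fun s => Real.Gamma β * mlG γ β (s ^ γ)) (by
      rw [uIcc_of_le ht.le]
      exact continuousOn_const.mul (mlG_comp_continuousOn h0 h1 hβ t))
  refine h.congr ?_
  intro s _
  have := (Real.Gamma_pos_of_pos hβ).ne'
  simp only [mlk, mlF]
  field_simp

lemma mlF_rec {γ β t : ℝ} (h0 : 0 < γ) (h1 : γ < 1) (hβ : 0 < β) (ht : 0 < t) :
    mlF γ β t + mlF γ (β + γ) t = mlk β t := by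
  have a := mlF_hasSum h0 h1 hβ ht
  have b := (mlF_hasSum h0 h1 (add_pos hβ h0) ht).neg
  rw [hasSum_nat_add_iff' 1 |>.symm] at a
  have c := a.unique (b.congr_fun (fun n => ?_))
  · simp at c
    linarith
  · rw [show γ * ((n + 1 : ℕ) : ℝ) + β = γ * n + (β + γ) by push_cast; ring]
    ring

lemma mlk_integral {γ a b : ℝ} (h0 : 0 < γ) (_hab : a ≤ b) :
    IntervalIntegrable (fun s => mlk γ (b - s)) volume a b ∧
    ∫ s in a..b, mlk γ (b - s) = (b - a) ^ γ / Real.Gamma (γ + 1) := by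
  have hG := (Real.Gamma_pos_of_pos h0).ne'
  constructor
  · have : IntervalIntegrable (fun s : ℝ => s ^ (γ - 1)) volume (b - a) (b - b) :=
      intervalIntegral.intervalIntegrable_rpow' (by linarith)
    have h2 := this.comp_sub_left b
    simp only [sub_sub_cancel] at h2
    exact h2.div_const _
  · rw [intervalIntegral.integral_comp_sub_left (fun s => mlk γ s) b]
    simp only [mlk]
    rw [intervalIntegral.integral_div, integral_rpow (Or.inl (by linarith)),
      Real.Gamma_add_one h0.ne']
    simp [Real.zero_rpow h0.ne']
    field_simp

lemma mlF_pos {γ t : ℝ} (h0 : 0 < γ) (h1 : γ < 1) (ht : 0 < t) : 0 < mlF γ γ t := by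
  have hG := Real.Gamma_pos_of_pos h0
  have hG1 := Real.Gamma_pos_of_pos (by linarith : 0 < γ + 1)
  by_contra hneg
  have hcont := mlG_comp_continuousOn h0 h1 h0 t
  have hFG : ∀ s, 0 < s → (0 < mlF γ γ s ↔ 0 < mlG γ γ (s ^ γ)) := fun s hs => by
    rw [mlF, mul_pos_iff_of_pos_left (Real.rpow_pos_of_pos hs _)]
  have hZ : IsCompact {s ∈ Icc 0 t | mlG γ γ (s ^ γ) ≤ 0} := by
    have : IsClosed (Icc 0 t ∩ (fun s => mlG γ γ (s ^ γ)) ⁻¹' Iic 0) :=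
      hcont.preimage_isClosed_of_isClosed isClosed_Icc isClosed_Iic
    exact isCompact_Icc.of_isClosed_subset this (fun x hx => hx.1)
  obtain ⟨t0, ⟨⟨ht00, ht0t⟩, ht0n⟩, hmin⟩ := hZ.exists_isLeast
    ⟨t, ⟨ht.le, le_rfl⟩, by rw [hFG t ht] at hneg; exact not_lt.mp hneg⟩
  have hz : mlG γ γ ((0:ℝ) ^ γ) = 1 / Real.Gamma γ := by
    rw [mlG, Real.zero_rpow h0.ne', tsum_eq_single 0]
    · simp
    · intro n hn; simp [hn]
  have ht0p : 0 < t0 := by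
    rcases ht00.eq_or_lt with h | h
    · rw [← h, hz] at ht0n
      have : 0 < 1 / Real.Gamma γ := by positivity
      linarith
    · exact h
  have hpos : ∀ s, 0 < s → s < t0 → 0 < mlF γ γ s := by
    intro s hs hs2
    rw [hFG s hs]
    by_contra hc
    exact absurd (hmin ⟨⟨hs.le, by linarith⟩, not_lt.mp hc⟩) (not_le.mpr hs2)
  have hv0 : mlF γ γ t0 ≤ 0 := by
    rw [← not_lt, hFG t0 ht0p]; exact not_lt.mpr ht0n
  -- choose `a`
  have hφ : ContinuousAt (fun s : ℝ => (s / t0) ^ (1 - γ) - (t0 - s) ^ γ / Real.Gamma (γ + 1)) t0 := by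
    apply ContinuousAt.sub
    · exact (continuousAt_id.div_const t0).rpow_const (Or.inr (by linarith))
    · exact ((continuousAt_const.sub continuousAt_id).rpow_const (Or.inr h0.le)).div_const _
  have hev : ∀ᶠ s in 𝓝 t0, 0 < (s / t0) ^ (1 - γ) - (t0 - s) ^ γ / Real.Gamma (γ + 1) := by
    apply hφ.eventually_const_lt
    simp [div_self ht0p.ne', Real.zero_rpow h0.ne']
  obtain ⟨ε, hε, hball⟩ := Metric.eventually_nhds_iff.mp hev
  set a := max (t0 / 2) (t0 - ε / 2) with ha
  have ha0 : 0 < a := lt_max_of_lt_left (by linarith)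
  have hat : a < t0 := max_lt (by linarith) (by linarith)
  have haε : t0 - ε / 2 ≤ a := le_max_right _ _
  have hvc : ContinuousOn (mlF γ γ) (Icc a t0) := by
    apply ContinuousOn.mul
    · intro s hs
      exact (Real.continuousAt_rpow_const _ _ (Or.inl (by linarith [hs.1]))).continuousWithinAt
    · exact hcont.mono (fun s hs => ⟨by linarith [hs.1], by linarith [hs.2]⟩)
  obtain ⟨b, hb, hbmax⟩ := isCompact_Icc.exists_isMaxOn ⟨a, le_rfl, hat.le⟩ hvc
  have hM : 0 < mlF γ γ b := (hpos a ha0 hat).trans_le (hbmax ⟨le_rfl, hat.le⟩)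
  have hbt : b < t0 := by
    rcases hb.2.eq_or_lt with h | h
    · rw [h] at hM; linarith
    · exact h
  have hb0 : 0 < b := by linarith [hb.1]
  have hbφ := hball (y := b) (by rw [Real.dist_eq, abs_lt]; constructor <;> linarith [hb.1])
  -- equations
  have e1 := mlF_conv h0 h1 h0 h0 ht0p
  have e1' := mlF_rec h0 h1 h0 ht0p
  have e2 := mlF_conv h0 h1 h0 h0 hb0
  have e2' := mlF_rec h0 h1 h0 hb0
  have i1 := mlF_conv_int h0 h1 h0 h0 ht0p
  have i2 := mlF_conv_int h0 h1 h0 h0 hb0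
  have i1a := i1.mono_set (c := 0) (d := b) (by
    rw [uIcc_of_le hb0.le, uIcc_of_le ht0p.le]; exact Icc_subset_Icc le_rfl hbt.le)
  have i1b := i1.mono_set (c := b) (d := t0) (by
    rw [uIcc_of_le hbt.le, uIcc_of_le ht0p.le]; exact Icc_subset_Icc hb0.le le_rfl)
  have hsplit := intervalIntegral.integral_add_adjacent_intervals i1a i1b
  set c := (b / t0) ^ (1 - γ) with hc
  have hk : mlk γ t0 = c * mlk γ b := by
    rw [hc, mlk, mlk, Real.div_rpow hb0.le ht0p.le, show γ - 1 = -(1 - γ) by ring,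
      Real.rpow_neg ht0p.le, Real.rpow_neg hb0.le]
    have := (Real.rpow_pos_of_pos hb0 (1 - γ)).ne'
    field_simp
  have m1 : ∫ s in (0:ℝ)..b, mlk γ (t0 - s) * mlF γ γ s
      ≤ ∫ s in (0:ℝ)..b, c * (mlk γ (b - s) * mlF γ γ s) := by
    apply intervalIntegral.integral_mono_on_of_le_Ioo hb0.le i1a (i2.const_mul c)
    intro s hs
    have hs1 : 0 < b - s := by linarith [hs.2]
    have hs2 : 0 < t0 - s := by linarith [hs.2]
    have hv := hpos s hs.1 (by linarith [hs.2])
    rw [← mul_assoc]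
    refine mul_le_mul_of_nonneg_right ?_ hv.le
    have hcmp : ((b - s) / (t0 - s)) ^ (1 - γ) ≤ c := by
      apply Real.rpow_le_rpow (by positivity) _ (by linarith)
      rw [div_le_div_iff₀ hs2 ht0p]
      nlinarith [hs.1]
    have hk2 : mlk γ (t0 - s) = ((b - s) / (t0 - s)) ^ (1 - γ) * mlk γ (b - s) := by
      rw [mlk, mlk, Real.div_rpow hs1.le hs2.le, show γ - 1 = -(1 - γ) by ring,
        Real.rpow_neg hs1.le, Real.rpow_neg hs2.le]
      have := (Real.rpow_pos_of_pos hs1 (1 - γ)).ne'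
      field_simp
    rw [hk2]
    exact mul_le_mul_of_nonneg_right hcmp (mlk_nonneg h0 hs1.le)
  have ⟨ik, ek⟩ := mlk_integral h0 hbt.le
  have m2 : ∫ s in b..t0, mlk γ (t0 - s) * mlF γ γ s
      ≤ ∫ s in b..t0, mlk γ (t0 - s) * mlF γ γ b := by
    apply intervalIntegral.integral_mono_on_of_le_Ioo hbt.le i1b (ik.mul_const _)
    intro s hs
    exact mul_le_mul_of_nonneg_left (hbmax ⟨by linarith [hb.1, hs.1], hs.2.le⟩)
      (mlk_nonneg h0 (by linarith [hs.2]))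
  rw [intervalIntegral.integral_const_mul, e2] at m1
  rw [intervalIntegral.integral_mul_const, ek] at m2
  have f1 := mul_pos hbφ hM
  rw [sub_mul] at f1
  rw [← e2', mul_add] at hk
  linarith

lemma mlF_one {γ t : ℝ} : mlF γ 1 t = mlE γ (-(t ^ γ)) := by
  simp [mlF, mlG, mlE]

lemma mlk_one {t : ℝ} : mlk 1 t = 1 := by simp [mlk]

lemma mlF_one_eq {γ t : ℝ} (h0 : 0 < γ) (h1 : γ < 1) (ht : 0 < t) :
    IntervalIntegrable (mlF γ γ) volume 0 t ∧ ∫ s in (0:ℝ)..t, mlF γ γ s = 1 - mlF γ 1 t := by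
  have a := mlF_conv h0 h1 h0 one_pos ht
  have b := mlF_conv_int h0 h1 h0 one_pos ht
  have c := mlF_rec h0 h1 one_pos ht
  simp only [mlk_one, one_mul] at a b c
  refine ⟨b, ?_⟩
  rw [a, add_comm γ 1]; linarith

lemma mlF_lower {γ t : ℝ} (h0 : 0 < γ) (h1 : γ < 1) (ht : 0 < t) :
    1 / (1 + Real.Gamma (1 - γ) * t ^ γ) ≤ mlF γ 1 t := by
  obtain ⟨iv, ev⟩ := mlF_one_eq h0 h1 ht
  have hd : 0 < 1 - γ := by linarith
  have hG := Real.Gamma_pos_of_pos hd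
  have a := mlF_conv h0 h1 h0 hd ht
  have b := mlF_conv_int h0 h1 h0 hd ht
  have m : ∫ s in (0:ℝ)..t, mlk (1 - γ) t * mlF γ γ s
      ≤ ∫ s in (0:ℝ)..t, mlk (1 - γ) (t - s) * mlF γ γ s := by
    apply intervalIntegral.integral_mono_on_of_le_Ioo ht.le (iv.const_mul _) b
    intro s hs
    refine mul_le_mul_of_nonneg_right ?_ (mlF_pos h0 h1 hs.1).le
    unfold mlk
    refine div_le_div_of_nonneg_right ?_ hG.le
    exact Real.rpow_le_rpow_of_nonpos (by linarith [hs.2]) (by linarith [hs.1]) (by linarith)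
  rw [intervalIntegral.integral_const_mul, ev, a, show γ + (1 - γ) = 1 by ring, mlk,
    show 1 - γ - 1 = -γ by ring, Real.rpow_neg ht.le] at m
  have htp := Real.rpow_pos_of_pos ht γ
  rw [div_le_iff₀ (by positivity)]
  have : (t ^ γ)⁻¹ / Real.Gamma (1 - γ) = 1 / (Real.Gamma (1 - γ) * t ^ γ) := by field_simp
  rw [this, div_mul_eq_mul_div, div_le_iff₀ (by positivity)] at m
  linarith

lemma mlF_anti {γ s t : ℝ} (h0 : 0 < γ) (h1 : γ < 1) (hs : 0 < s) (hst : s ≤ t) :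
    mlF γ 1 t ≤ mlF γ 1 s := by
  obtain ⟨iv, ev⟩ := mlF_one_eq h0 h1 (hs.trans_le hst)
  obtain ⟨iv', ev'⟩ := mlF_one_eq h0 h1 hs
  have h := intervalIntegral.integral_interval_sub_left iv iv'
  have : 0 ≤ ∫ x in s..t, mlF γ γ x :=
    intervalIntegral.integral_nonneg hst (fun u hu => (mlF_pos h0 h1 (hs.trans_le hu.1)).le)
  linarith

lemma mlF_upper {γ t : ℝ} (h0 : 0 < γ) (h1 : γ < 1) (ht : 0 < t) :
    mlF γ 1 t ≤ 1 / (1 + t ^ γ / Real.Gamma (1 + γ)) := by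
  have hG := Real.Gamma_pos_of_pos (by linarith : 0 < 1 + γ)
  have a := mlF_conv h0 h1 one_pos h0 ht
  have b := mlF_conv_int h0 h1 one_pos h0 ht
  have c := mlF_rec h0 h1 one_pos ht
  obtain ⟨ik, ek⟩ := mlk_integral h0 ht.le
  have m : ∫ s in (0:ℝ)..t, mlk γ (t - s) * mlF γ 1 t
      ≤ ∫ s in (0:ℝ)..t, mlk γ (t - s) * mlF γ 1 s := by
    apply intervalIntegral.integral_mono_on_of_le_Ioo ht.le (ik.mul_const _) b
    intro s hs
    exact mul_le_mul_of_nonneg_left (mlF_anti h0 h1 hs.1 hs.2.le)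
      (mlk_nonneg h0 (by linarith [hs.2]))
  rw [intervalIntegral.integral_mul_const, ek, a, sub_zero, add_comm γ 1] at m
  rw [mlk_one] at c
  have htp := Real.rpow_pos_of_pos ht γ
  rw [le_div_iff₀ (by positivity)]
  linarith

lemma mlE_bounds {γ x : ℝ} (h0 : 0 < γ) (h1 : γ < 1) (hx : 0 ≤ x) :
    1 / (1 + Real.Gamma (1 - γ) * x) ≤ mlE γ (-x) ∧
      mlE γ (-x) ≤ 1 / (1 + x / Real.Gamma (1 + γ)) := by
  rcases hx.eq_or_lt with h | h
  · have : mlE γ (-x) = 1 := by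
      rw [← h, mlE, tsum_eq_single 0]
      · simp
      · intro n hn; simp [hn]
    rw [this, ← h]; simp
  · have e : (x ^ (1 / γ)) ^ γ = x := by
      rw [← Real.rpow_mul h.le, one_div, inv_mul_cancel₀ h0.ne', Real.rpow_one]
    have hp := Real.rpow_pos_of_pos h (1 / γ)
    have a := mlF_lower h0 h1 hp
    have b := mlF_upper h0 h1 hp
    rw [mlF_one, e] at a b
    exact ⟨a, b⟩

lemma ml_gamma_bdd {a b : ℝ} (ha : 0 < a) (hab : a ≤ b) :
    ∃ m M : ℝ, 0 < m ∧ ∀ x ∈ Icc a b, m ≤ Real.Gamma x ∧ Real.Gamma x ≤ M := by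
  have hc : ContinuousOn Real.Gamma (Icc a b) := by
    intro x hx
    refine (Real.differentiableAt_Gamma (fun m => ?_)).continuousAt.continuousWithinAt
    have : (0:ℝ) ≤ m := Nat.cast_nonneg m
    have := hx.1
    intro h; linarith
  obtain ⟨p, hp, hpm⟩ := isCompact_Icc.exists_isMinOn ⟨a, le_rfl, hab⟩ hc
  obtain ⟨q, hq, hqm⟩ := isCompact_Icc.exists_isMaxOn ⟨a, le_rfl, hab⟩ hc
  exact ⟨Real.Gamma p, Real.Gamma q, Real.Gamma_pos_of_pos (ha.trans_le hp.1),
    fun x hx => ⟨hpm hx, hqm hx⟩⟩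

theorem stmt_1 (γ0 γ1 : ℝ) (h0 : 0 < γ0) (h01 : γ0 ≤ γ1) (h1 : γ1 < 1) :
    ∃ C1 C2 : ℝ, 0 < C1 ∧ 0 < C2 ∧
      ∀ T : ℝ, 0 < T → ∀ γ ∈ Set.Icc γ0 γ1,
        ∀ (n : ℕ), 1 ≤ n → ∀ ξ : EuclideanSpace ℝ (Fin n),
          ∀ t : ℝ, 0 < t → t ≤ T →
            (1 / max 1 (t ^ γ)) * (C1 / (Real.Gamma (1 - γ) * (1 + ‖ξ‖ ^ 2)))
                ≤ mlE γ (-(‖ξ‖ ^ 2 * t ^ γ)) ∧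
              mlE γ (-(‖ξ‖ ^ 2 * t ^ γ))
                ≤ (1 / min 1 (t ^ γ)) * (C2 / (Real.Gamma (1 - γ) * (1 + ‖ξ‖ ^ 2))) := by
  obtain ⟨m, M, hm, hmM⟩ := ml_gamma_bdd (a := 1 - γ1) (b := 1 - γ0) (by linarith) (by linarith)
  obtain ⟨m', P, hm', hmP⟩ := ml_gamma_bdd (a := 1 + γ0) (b := 1 + γ1) (by linarith) (by linarith)
  have hM : 0 < M := by
    have := hmM (1 - γ1) ⟨le_rfl, by linarith⟩
    linarith [this.1, this.2]
  have hQ : 0 < max 1 P := lt_max_of_lt_left one_pos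
  refine ⟨min 1 m, M * max 1 P, lt_min one_pos hm, by positivity, ?_⟩
  intro T _ γ hγ n _ ξ t ht _
  obtain ⟨g1, g2⟩ := hmM (1 - γ) ⟨by linarith [hγ.2], by linarith [hγ.1]⟩
  obtain ⟨p1, p2⟩ := hmP (1 + γ) ⟨by linarith [hγ.1], by linarith [hγ.2]⟩
  have htp := Real.rpow_pos_of_pos ht γ
  have hr : 0 ≤ ‖ξ‖ ^ 2 := by positivity
  set r := ‖ξ‖ ^ 2
  set y := t ^ γ
  obtain ⟨b1, b2⟩ := mlE_bounds (γ := γ) (x := r * y) (by linarith [hγ.1]) (by linarith [hγ.2])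
    (by positivity)
  set g := Real.Gamma (1 - γ)
  set q := Real.Gamma (1 + γ)
  have hg : 0 < g := by linarith
  have hq : 0 < q := by linarith
  have hmx : 0 < max 1 y := lt_max_of_lt_left one_pos
  have hmn : 0 < min 1 y := lt_min one_pos htp
  have hry : 0 ≤ r * y := by positivity
  constructor
  · refine le_trans ?_ b1
    rw [div_mul_div_comm, one_mul, div_le_div_iff₀ (by positivity) (by positivity), one_mul]
    calc min 1 m * (1 + g * (r * y)) = min 1 m * 1 + min 1 m * (g * (r * y)) := by ring
      _ ≤ g * 1 + 1 * (g * (r * y)) := by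
          gcongr
          · exact (min_le_right _ _).trans g1
          · exact min_le_left _ _
      _ = g * (1 + r * y) := by ring
      _ ≤ g * (max 1 y + r * max 1 y) := by
          gcongr
          · exact le_max_left _ _
          · exact le_max_right _ _
      _ = _ := by ring
  · refine b2.trans ?_
    rw [div_mul_div_comm, one_mul, div_le_div_iff₀ (by positivity) (by positivity), one_mul]
    have k1 : 1 + r * y ≤ max 1 P * (1 + r * y / q) := by
      have : r * y ≤ max 1 P * (r * y / q) := by
        rw [← mul_div_assoc, le_div_iff₀ hq, mul_comm]
        gcongr
        exact p2.trans (le_max_right _ _)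
      have := le_max_left 1 P
      linarith
    calc min 1 y * (g * (1 + r)) = g * (min 1 y + r * min 1 y) := by ring
      _ ≤ M * (1 + r * y) := by
          gcongr
          · exact min_le_left _ _
          · exact min_le_right _ _
      _ ≤ M * (max 1 P * (1 + r * y / q)) := by gcongr
      _ = _ := by ring
end
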